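/- Under the stated hypotheses, for every z ∈ S the limit lim_{t→∞} ‖x(t) − z‖ exists and is a real number. -/

import Mathlib

open Filter MeasureTheory Set RealInnerProductSpace

/-- The gradient inequality for a differentiable convex function. -/
theorem ConvexOn.add_inner_gradient_le {H : Type*} [NormedAddCommGroup H] [InnerProductSpace ℝ H]
    [CompleteSpace H] {f : H → ℝ} (hf : ConvexOn ℝ univ f) (a b : H)
    (hd : DifferentiableAt ℝ f a) :
    f a + ⟪gradient f a, b - a⟫ ≤ f b := by
  have hconv : ConvexOn ℝ univ (f ∘ AffineMap.lineMap (k := ℝ) a b) := hf.comp_affineMap _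
  have hline : HasDerivAt (AffineMap.lineMap (k := ℝ) a b : ℝ → H) (b - a) 0 :=
    AffineMap.hasDerivAt_lineMap
  have hfa : HasFDerivAt f (InnerProductSpace.toDual ℝ H (gradient f a))
      (AffineMap.lineMap (k := ℝ) a b (0 : ℝ)) := by
    simpa using hd.hasGradientAt.hasFDerivAt
  have h := hconv.le_slope_of_hasDerivAt (mem_univ 0) (mem_univ 1) one_pos
    (hfa.comp_hasDerivAt 0 hline)
  simp only [slope_def_field, Function.comp_apply, AffineMap.lineMap_apply_zero,
    AffineMap.lineMap_apply_one, sub_zero, div_one, InnerProductSpace.toDual_apply_apply] at h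
  linarith

/-- Chain rule for the composition of a differentiable function with a curve. -/
theorem HasDerivWithinAt.comp_gradient {H : Type*} [NormedAddCommGroup H] [InnerProductSpace ℝ H]
    [CompleteSpace H] {f : H → ℝ} {x : ℝ → H} {v : H} {s : Set ℝ} {t : ℝ}
    (hx : HasDerivWithinAt x v s t) (hf : DifferentiableAt ℝ f (x t)) :
    HasDerivWithinAt (fun r => f (x r)) ⟪gradient f (x t), v⟫ s t :=
  (hf.hasGradientAt.hasFDerivAt.comp_hasDerivWithinAt t hx).congr_deriv <| by
    rw [InnerProductSpace.toDual_apply_apply]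

/-- First-order optimality condition for minimization over a convex set. -/
theorem IsMinOn.inner_gradient_nonneg {H : Type*} [NormedAddCommGroup H] [InnerProductSpace ℝ H]
    [CompleteSpace H] {f : H → ℝ} {C : Set H} {z y : H} (hmin : IsMinOn f C z) (hC : Convex ℝ C)
    (hz : z ∈ C) (hy : y ∈ C) (hd : DifferentiableAt ℝ f z) :
    0 ≤ ⟪gradient f z, y - z⟫ := by
  have h := hmin.localize.hasFDerivWithinAt_nonneg
    hd.hasGradientAt.hasFDerivAt.hasFDerivWithinAt
    (sub_mem_posTangentConeAt_of_segment_subset (hC.segment_subset hz hy))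
  simpa using h

/-- A function bounded below on `[0, ∞)` whose derivative is dominated by an integrable function
converges at infinity. -/
theorem exists_tendsto_of_hasDerivWithinAt_le_integrableOn {f f' g : ℝ → ℝ} {m : ℝ}
    (hf : ∀ t ∈ Ici (0 : ℝ), HasDerivWithinAt f (f' t) (Ici 0) t)
    (hg : IntegrableOn g (Ici 0)) (hle : ∀ t ∈ Ici (0 : ℝ), f' t ≤ g t)
    (hm : ∀ t ∈ Ici (0 : ℝ), m ≤ f t) :
    ∃ l, Tendsto f atTop (nhds l) := by
  set G : ℝ → ℝ := fun t => ∫ s in (0 : ℝ)..t, g s with hG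
  have hint : ∀ a ∈ Ici (0 : ℝ), ∀ b ∈ Ici (0 : ℝ), IntervalIntegrable g volume a b := by
    intro a ha b hb
    refine (hg.mono_set fun s hs => ?_).intervalIntegrable
    exact (le_min ha hb).trans hs.1
  have hGlim : Tendsto G atTop (nhds (∫ s in Ioi (0 : ℝ), g s)) :=
    intervalIntegral_tendsto_integral_Ioi 0 (hg.mono_set Ioi_subset_Ici_self) tendsto_id
  have hanti : ∀ a ∈ Ici (0 : ℝ), ∀ b, a ≤ b → f b - G b ≤ f a - G a := by
    intro a ha b hab
    have hb : b ∈ Ici (0 : ℝ) := le_trans ha hab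
    have hsub : Icc a b ⊆ Ici (0 : ℝ) := fun s hs => le_trans ha hs.1
    have h1 := intervalIntegral.sub_le_integral_of_hasDeriv_right_of_le hab
      (fun s hs => (hf s (hsub hs)).continuousWithinAt.mono hsub)
      (fun s hs => (hf s (hsub (Ioo_subset_Icc_self hs))).mono
        (Ioi_subset_Ici (hsub (Ioo_subset_Icc_self hs))))
      (hg.mono_set hsub) (fun s hs => hle s (hsub (Ioo_subset_Icc_self hs)))
    have h2 : G a + ∫ s in a..b, g s = G b :=
      intervalIntegral.integral_add_adjacent_intervals (hint 0 self_mem_Ici a ha) (hint a ha b hb)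
    linarith
  have hanti' : Antitone fun t => f (max t 0) - G (max t 0) := fun a b hab =>
    hanti _ (mem_Ici.2 (le_max_right _ _)) _ (max_le_max_right 0 hab)
  have hbdd : BddBelow (range fun t => f (max t 0) - G (max t 0)) := by
    refine ⟨m - ((∫ s in Ioi (0 : ℝ), g s) + 1), ?_⟩
    rintro _ ⟨t, rfl⟩
    obtain ⟨T, hTt, hT⟩ := ((eventually_ge_atTop (max t 0)).and
      (hGlim.eventually (gt_mem_nhds (lt_add_one _)))).exists
    have h1 := hanti _ (le_max_right t 0) T hTt
    have h2 := hm T (le_trans (le_max_right t 0) hTt)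
    simp only
    linarith
  have hlim := (tendsto_atTop_ciInf hanti' hbdd).congr' <|
    (eventually_ge_atTop (0 : ℝ)).mono fun t ht => by rw [max_eq_left ht]
  exact ⟨_, (hlim.add hGlim).congr fun t => by ring⟩

/-- If `u' + γ u` is eventually at most `0`, then `u` is eventually below every positive number. -/
theorem eventually_lt_of_hasDerivWithinAt_add_mul_nonpos {u u' : ℝ → ℝ} {γ ε : ℝ} (hγ : 0 < γ)
    (hε : 0 < ε) (hu : ∀ t ∈ Ici (0 : ℝ), HasDerivWithinAt u (u' t) (Ici 0) t)
    (hle : ∀ᶠ t in atTop, u' t + γ * u t ≤ 0) :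
    ∀ᶠ t in atTop, u t < ε := by
  obtain ⟨T, hT0, hT⟩ := ((eventually_ge_atTop (0 : ℝ)).and
    (eventually_forall_ge_atTop.2 hle)).exists
  have hsub : Ici T ⊆ Ici (0 : ℝ) := Ici_subset_Ici.2 hT0
  have hder : ∀ t ∈ Ici T, HasDerivWithinAt (fun t => Real.exp (γ * t) * u t)
      (Real.exp (γ * t) * (u' t + γ * u t)) (Ici T) t := by
    intro t ht
    have h1 : HasDerivAt (fun t => Real.exp (γ * t)) (Real.exp (γ * t) * (γ * 1)) t :=
      ((hasDerivAt_id t).const_mul γ).exp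
    refine (h1.hasDerivWithinAt.mul ((hu t (hsub ht)).mono hsub)).congr_deriv ?_
    ring
  have hanti : AntitoneOn (fun t => Real.exp (γ * t) * u t) (Ici T) := by
    refine antitoneOn_of_hasDerivWithinAt_nonpos (convex_Ici T)
      (fun t ht => (hder t ht).continuousWithinAt)
      (fun t ht => (hder t (interior_subset ht)).mono interior_subset) fun t ht => ?_
    exact mul_nonpos_of_nonneg_of_nonpos (Real.exp_pos _).le (hT t (interior_subset ht))
  have hexp : Tendsto (fun t => Real.exp (γ * t)) atTop atTop :=
    Real.tendsto_exp_atTop.comp (tendsto_id.const_mul_atTop hγ)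
  filter_upwards [eventually_ge_atTop T,
    hexp.eventually_gt_atTop (Real.exp (γ * T) * u T / ε)] with t ht hlt
  have h1 := hanti self_mem_Ici ht ht
  rw [div_lt_iff₀ hε] at hlt
  exact lt_of_mul_lt_mul_left (h1.trans_lt hlt) (Real.exp_pos _).le

/-- If `u' + γ u` converges to `l` with `γ > 0`, then `u` converges to `l / γ`. -/
theorem tendsto_of_tendsto_hasDerivWithinAt_add_mul {u u' : ℝ → ℝ} {γ l : ℝ} (hγ : 0 < γ)
    (hu : ∀ t ∈ Ici (0 : ℝ), HasDerivWithinAt u (u' t) (Ici 0) t)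
    (hl : Tendsto (fun t => u' t + γ * u t) atTop (nhds l)) :
    Tendsto u atTop (nhds (l / γ)) := by
  have hlγ : γ * (l / γ) = l := mul_div_cancel₀ l hγ.ne'
  refine tendsto_order.2 ⟨fun a ha => ?_, fun a ha => ?_⟩
  · set ε := (l / γ - a) / 2 with hε
    have hε0 : 0 < ε := by linarith
    have h := eventually_lt_of_hasDerivWithinAt_add_mul_nonpos (u := fun t => l / γ - ε - u t)
      (u' := fun t => -u' t) hγ hε0 (fun t ht => (hu t ht).const_sub _)
      ((hl.eventually (lt_mem_nhds (sub_lt_self l (mul_pos hγ hε0)))).mono fun t ht => by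
        nlinarith)
    filter_upwards [h] with t ht
    linarith
  · set ε := (a - l / γ) / 2 with hε
    have hε0 : 0 < ε := by linarith
    have h := eventually_lt_of_hasDerivWithinAt_add_mul_nonpos (u := fun t => u t - (l / γ + ε))
      (u' := u') hγ hε0 (fun t ht => (hu t ht).sub_const _)
      ((hl.eventually (gt_mem_nhds (lt_add_of_pos_right l (mul_pos hγ hε0)))).mono fun t ht => by
        nlinarith)
    filter_upwards [h] with t ht
    linarith

theorem stmt8 {H : Type*} [NormedAddCommGroup H] [InnerProductSpace ℝ H] [CompleteSpace H]
    (φ ψ : H → ℝ) (γ k : ℝ) (β β' : ℝ → ℝ) (x x' x'' : ℝ → H)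
    -- ψ is convex, Fréchet differentiable with Lipschitz continuous gradient,
    -- nonnegative, and argmin ψ = ψ⁻¹(0) is nonempty
    (hψconv : ConvexOn ℝ univ ψ)
    (hψdiff : Differentiable ℝ ψ)
    (hψlip : ∃ L : NNReal, LipschitzWith L (gradient ψ))
    (hψnonneg : ∀ y, 0 ≤ ψ y)
    (hψmin : ∃ y, ψ y = 0)
    -- φ is convex, Fréchet differentiable with Lipschitz continuous gradient,
    -- bounded from below, and S = {z ∈ argmin ψ : φ z ≤ φ y ∀ y ∈ argmin ψ} is nonempty
    (hφconv : ConvexOn ℝ univ φ)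
    (hφdiff : Differentiable ℝ φ)
    (hφlip : ∃ L : NNReal, LipschitzWith L (gradient φ))
    (hφbdd : BddBelow (range φ))
    (hS : ∃ z : H, ψ z = 0 ∧ ∀ y, ψ y = 0 → φ z ≤ φ y)
    -- γ > 0, 0 ≤ k < γ, and β : [0,∞) → (0,∞) is a C¹ function (with derivative β')
    -- satisfying the growth condition 0 ≤ β' ≤ k β
    (hγ : 0 < γ) (hk : 0 ≤ k) (hkγ : k < γ)
    (hβpos : ∀ t ∈ Ici (0 : ℝ), 0 < β t)
    (hβderiv : ∀ t ∈ Ici (0 : ℝ), HasDerivWithinAt β (β' t) (Ici 0) t)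
    (hβ'cont : ContinuousOn β' (Ici 0))
    (hβgrowth : ∀ t ∈ Ici (0 : ℝ), 0 ≤ β' t ∧ β' t ≤ k * β t)
    -- condition (H): for every p in the range of the normal cone to argmin ψ (i.e.
    -- p ∈ N(z) for some z ∈ argmin ψ = ψ⁻¹(0)), the integral
    -- ∫_0^∞ β(t) [ψ*(p/β(t)) - σ(p/β(t))] dt is finite; here σ(p/β(t)) = ⟪p/β(t), z⟫
    -- since p ∈ N(z), and β(t)[ψ*(q) - ⟪q, z⟫] = ⨆ w, β(t)((⟪q, w⟫ - ψ w) - ⟪q, z⟫) ≥ 0.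
    (hH : ∀ z p : H, ψ z = 0 → (∀ y, ψ y = 0 → ⟪p, y - z⟫ ≤ 0) →
      ∫⁻ t in Ici (0 : ℝ), ⨆ w : H,
        ENNReal.ofReal (β t * ((⟪(β t)⁻¹ • p, w⟫ - ψ w) - ⟪(β t)⁻¹ • p, z⟫)) ≠ ⊤)
    -- x : [0,∞) → H is twice continuously differentiable (first derivative x',
    -- second derivative x'') and satisfies ẍ + γ ẋ + ∇φ(x) + β ∇ψ(x) = 0 on [0,∞)
    (hx' : ∀ t ∈ Ici (0 : ℝ), HasDerivWithinAt x (x' t) (Ici 0) t)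
    (hx'' : ∀ t ∈ Ici (0 : ℝ), HasDerivWithinAt x' (x'' t) (Ici 0) t)
    (hx''cont : ContinuousOn x'' (Ici 0))
    (hode : ∀ t ∈ Ici (0 : ℝ),
      x'' t + γ • x' t + gradient φ (x t) + β t • gradient ψ (x t) = 0) :
    ∀ z : H, (ψ z = 0 ∧ ∀ y, ψ y = 0 → φ z ≤ φ y) →
      ∃ L : ℝ, Tendsto (fun t => ‖x t - z‖) atTop (nhds L) := by
  rintro z ⟨hz, hzmin⟩
  obtain ⟨m, hm⟩ := hφbdd
  have hm : ∀ y, m ≤ φ y := fun y => hm (mem_range_self y)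
  have hconvC : Convex ℝ {y | ψ y = 0} := by
    have : {y | ψ y = 0} = {y ∈ univ | ψ y ≤ 0} := by
      ext y
      simp [le_antisymm_iff, hψnonneg y]
    rw [this]
    exact hψconv.convex_le 0
  have hnormal : ∀ y, ψ y = 0 → 0 ≤ ⟪gradient φ z, y - z⟫ := fun y hy =>
    IsMinOn.inner_gradient_nonneg (C := {y | ψ y = 0}) hzmin hconvC hz hy (hφdiff z)
  have hxc : ContinuousOn x (Ici 0) := fun t ht => (hx' t ht).continuousWithinAt
  have hβc : ContinuousOn β (Ici 0) := fun t ht => (hβderiv t ht).continuousWithinAt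
  -- The positive part of `⟪-d ∇φ(z), x - z⟫ - β ψ(x)` is integrable, by condition (H).
  have hint : ∀ d : ℝ, 0 ≤ d → IntegrableOn
      (fun t => max (-(d * ⟪gradient φ z, x t - z⟫) - β t * ψ (x t)) 0) (Ici 0) := by
    intro d hd
    have hcont : ContinuousOn
        (fun t => max (-(d * ⟪gradient φ z, x t - z⟫) - β t * ψ (x t)) 0) (Ici 0) := by
      have := hψdiff.continuous
      fun_prop
    refine ⟨hcont.aestronglyMeasurable measurableSet_Ici, ?_⟩
    refine (hasFiniteIntegral_iff_ofReal (Eventually.of_forall fun t => le_max_right _ _)).2 ?_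
    have hfin := hH z (-(d • gradient φ z)) hz fun y hy => by
      rw [inner_neg_left, real_inner_smul_left]
      have := mul_nonneg hd (hnormal y hy)
      linarith
    refine lt_of_le_of_lt (setLIntegral_mono' measurableSet_Ici fun t ht => ?_) hfin.lt_top
    refine le_trans ?_ (le_iSup _ (x t))
    have hβt := (hβpos t ht).ne'
    rw [ENNReal.ofReal_max, Pi.zero_apply, ENNReal.ofReal_zero, max_eq_left zero_le]
    refine ENNReal.ofReal_le_ofReal (le_of_eq ?_)
    simp only [inner_neg_left, real_inner_smul_left, inner_sub_right]
    field_simp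
    ring
  set h : ℝ → ℝ := fun t => ‖x t - z‖ ^ 2 / 2 with hh
  set h' : ℝ → ℝ := fun t => ⟪x t - z, x' t⟫ with hh'
  have hder : ∀ t ∈ Ici (0 : ℝ), HasDerivWithinAt h (h' t) (Ici 0) t := fun t ht =>
    ((((hx' t ht).sub_const z).norm_sq).div_const 2).congr_deriv (by simp [hh'])
  have hder' : ∀ t ∈ Ici (0 : ℝ),
      HasDerivWithinAt h' (⟪x t - z, x'' t⟫ + ⟪x' t, x' t⟫) (Ici 0) t := fun t ht =>
    ((hx' t ht).sub_const z).inner ℝ (hx'' t ht)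
  have henergy : ∀ c : ℝ, k < c → c ≤ γ → ∃ l, Tendsto (fun t =>
      (‖x' t‖ ^ 2 / 2 + φ (x t) + β t * ψ (x t)) + c * (h' t + γ * h t)) atTop (nhds l) := by
    intro c hkc hcγ
    have hc : 0 < c := hk.trans_lt hkc
    have hck : 0 < c - k := sub_pos.2 hkc
    refine exists_tendsto_of_hasDerivWithinAt_le_integrableOn (m := m)
      (fun t ht => ((((hx'' t ht).norm_sq.div_const 2).add
        ((hx' t ht).comp_gradient (hφdiff (x t)))).add
        ((hβderiv t ht).mul ((hx' t ht).comp_gradient (hψdiff (x t))))).add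
        (((hder' t ht).add ((hder t ht).const_mul γ)).const_mul c))
      ((hint (c / (c - k)) (by positivity)).const_mul (c - k)) ?_ ?_
    · intro t ht
      have hβt := hβpos t ht
      have hacc : x'' t = -(γ • x' t) - gradient φ (x t) - β t • gradient ψ (x t) := by
        rw [← sub_eq_zero, ← hode t ht]
        abel
      have hφ1 := hφconv.add_inner_gradient_le (x t) z (hφdiff _)
      have hφ2 := hφconv.add_inner_gradient_le z (x t) (hφdiff _)
      have hψ1 := hψconv.add_inner_gradient_le (x t) z (hψdiff _)
      rw [← neg_sub (x t) z, inner_neg_right, real_inner_comm] at hφ1 hψ1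
      have hβψ := mul_le_mul_of_nonneg_left (hψ1.trans_eq hz) hβt.le
      have hgr := mul_le_mul_of_nonneg_right (hβgrowth t ht).2 (hψnonneg (x t))
      have hv := mul_nonneg (sub_nonneg.2 hcγ) (sq_nonneg ‖x' t‖)
      have hmax : -(c * ⟪gradient φ z, x t - z⟫) - (c - k) * (β t * ψ (x t)) ≤
          (c - k) * max (-(c / (c - k) * ⟪gradient φ z, x t - z⟫) - β t * ψ (x t)) 0 := by
        refine le_trans (le_of_eq ?_) (mul_le_mul_of_nonneg_left (le_max_left _ _) hck.le)
        field_simp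
      refine le_trans ?_ hmax
      rw [hacc]
      simp only [hh', inner_sub_right (𝕜 := ℝ) (x' t), inner_neg_right,
        real_inner_smul_right, real_inner_self_eq_norm_sq,
        inner_sub_right (𝕜 := ℝ) (x t - z)]
      rw [real_inner_comm (gradient φ (x t)) (x' t), real_inner_comm (gradient ψ (x t)) (x' t)]
      nlinarith [mul_le_mul_of_nonneg_left hβψ hc.le, mul_le_mul_of_nonneg_left hφ1 hc.le,
        mul_le_mul_of_nonneg_left hφ2 hc.le]
    · intro t ht
      have h1 := mul_nonneg (hβpos t ht).le (hψnonneg (x t))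
      have h2 : 0 ≤ ‖x' t + c • (x t - z)‖ ^ 2 := sq_nonneg _
      rw [norm_add_sq_real, norm_smul, real_inner_smul_right, real_inner_comm, mul_pow,
        Real.norm_eq_abs, sq_abs] at h2
      have h3 := mul_nonneg (mul_nonneg hc.le (sub_nonneg.2 hcγ)) (sq_nonneg ‖x t - z‖)
      have h4 := hm (x t)
      simp only [hh, hh']
      nlinarith
  obtain ⟨l₁, hl₁⟩ := henergy γ hkγ le_rfl
  obtain ⟨l₂, hl₂⟩ := henergy ((k + γ) / 2) (by linarith) (by linarith)
  have hlim : Tendsto (fun t => h' t + γ * h t) atTop (nhds ((l₁ - l₂) / ((γ - k) / 2))) := by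
    refine ((hl₁.sub hl₂).div_const ((γ - k) / 2)).congr fun t => ?_
    have : γ - k ≠ 0 := (sub_pos.2 hkγ).ne'
    field_simp
    ring
  have hhlim := tendsto_of_tendsto_hasDerivWithinAt_add_mul hγ hder hlim
  refine ⟨_, ((hhlim.const_mul 2).sqrt).congr fun t => ?_⟩
  simp only [hh]
  rw [mul_div_cancel₀ _ two_ne_zero, Real.sqrt_sq (norm_nonneg _)]
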